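/- Let n ≥ 2, ρ = (n−1)/2, and let λ be either purely imaginary with nonnegative imaginary part or real with 0 < λ < ρ. Let y ∈ Γ⁺(eₙ) ∪ Γ⁻(eₙ), and set s = +1 if y₀ > 0 and s = −1 if y₀ < 0. Then for every t ∈ (0, π/2) the number (1+[z_t, y])/2 lies in ℂ∖[1,∞), the one-sided limit L = lim_{ε→0⁺} F_λ((1+yₙ)/2 − s·iε) exists, and lim_{t→π/2⁻} F_λ((1+[z_t, y])/2) = L; i.e. inside the future (resp. past) cone of eₙ the boundary value Ψ^λ(y) equals F_λ((1+yₙ)/2 − i0) (resp. F_λ((1+yₙ)/2 + i0)). -/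

import Mathlib

open scoped BigOperators
open Filter Topology

noncomputable section

/-- The Lorentzian bilinear form on `ℝ^{1+n}`. -/
def lformR (n : ℕ) (x y : Fin (n+1) → ℝ) : ℝ :=
  ∑ i, (if i = 0 then (-1 : ℝ) else 1) * x i * y i

/-- The complex-bilinear Lorentzian form on `ℂ^{1+n}`. -/
def lformC (n : ℕ) (z w : Fin (n+1) → ℂ) : ℂ :=
  ∑ i, (if i = 0 then (-1 : ℂ) else 1) * z i * w i

/-- The matrix `η = diag(−1,1,…,1)`. -/
def eta (n : ℕ) : Matrix (Fin (n+1)) (Fin (n+1)) ℝ :=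
  Matrix.diagonal (fun i => if i = 0 then (-1 : ℝ) else 1)

/-- Membership in `G = SO(1,n)_e`. -/
def memG (n : ℕ) (g : Matrix (Fin (n+1)) (Fin (n+1)) ℝ) : Prop :=
  g.transpose * eta n * g = eta n ∧ g.det = 1 ∧ 0 < g 0 0

/-- Standard basis vector `e₀`. -/
def e0 (n : ℕ) : Fin (n+1) → ℝ := fun i => if i = 0 then 1 else 0

/-- Standard basis vector `eₙ`. -/
def elast (n : ℕ) : Fin (n+1) → ℝ := fun i => if i = Fin.last n then 1 else 0

/-- Membership in `H = SO(1,n−1)_e`, the stabilizer of `eₙ`. -/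
def memH (n : ℕ) (g : Matrix (Fin (n+1)) (Fin (n+1)) ℝ) : Prop :=
  memG n g ∧ g.mulVec (elast n) = elast n

/-- Membership in `K = SO(n)`, the stabilizer of `e₀`. -/
def memK (n : ℕ) (g : Matrix (Fin (n+1)) (Fin (n+1)) ℝ) : Prop :=
  memG n g ∧ g.mulVec (e0 n) = e0 n

/-- The boost `a_t`. -/
def boost (n : ℕ) (t : ℝ) : Matrix (Fin (n+1)) (Fin (n+1)) ℝ :=
  Matrix.of fun i j =>
    if i = 0 ∧ j = 0 then Real.cosh t
    else if i = Fin.last n ∧ j = Fin.last n then Real.cosh t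
    else if (i = 0 ∧ j = Fin.last n) ∨ (i = Fin.last n ∧ j = 0) then Real.sinh t
    else if i = j then 1 else 0

/-- The upper hemisphere `S^n_+ = {(ix₀, 𝐱) : x₀ > 0, x₀² + |𝐱|² = 1}` in `ℂ^{1+n}`. -/
def Snplus (n : ℕ) : Set (Fin (n+1) → ℂ) :=
  {z | ∃ x : Fin (n+1) → ℝ, 0 < x 0 ∧ (∑ i, (x i)^2) = 1 ∧
    z 0 = Complex.I * (x 0 : ℂ) ∧ ∀ i, i ≠ 0 → z i = (x i : ℂ)}

/-- The crown domain `Ξ = G · S^n_+ ⊂ ℂ^{1+n}`. -/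
def Xi (n : ℕ) : Set (Fin (n+1) → ℂ) :=
  {z | ∃ g w, memG n g ∧ w ∈ Snplus n ∧ z = (g.map (Complex.ofReal)).mulVec w}

/-- The conjugate crown `Ξ̄`. -/
def XiBar (n : ℕ) : Set (Fin (n+1) → ℂ) :=
  {z | (fun i => (starRingEnd ℂ) (z i)) ∈ Xi n}

/-- The de Sitter space `dS^n` viewed inside `ℂ^{1+n}`. -/
def dSC (n : ℕ) : Set (Fin (n+1) → ℂ) :=
  {z | (∀ i, (z i).im = 0) ∧ lformC n z z = 1}

/-- The cut `[1,∞) ⊂ ℂ`. -/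
def slit : Set ℂ := {z | z.im = 0 ∧ 1 ≤ z.re}

/-- Componentwise complex conjugation on `ℂ^{1+n}`. -/
def conjVec (n : ℕ) (z : Fin (n+1) → ℂ) : Fin (n+1) → ℂ :=
  fun i => (starRingEnd ℂ) (z i)

/-- `λ` is admissible: purely imaginary with nonnegative imaginary part, or
real with `0 < λ < ρ = (n−1)/2`. -/
def admissible (n : ℕ) (lam : ℂ) : Prop :=
  (lam.re = 0 ∧ 0 ≤ lam.im) ∨ (lam.im = 0 ∧ 0 < lam.re ∧ lam.re < ((n : ℝ) - 1)/2)

/-- Euler's integral representation of `₂F₁(ρ+λ, ρ−λ; n/2; ·)` on `ℂ∖[1,∞)`,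
with `ρ = (n−1)/2`. -/
def Flam (n : ℕ) (lam : ℂ) (z : ℂ) : ℂ :=
  (Complex.Gamma ((n : ℂ)/2) /
    (Complex.Gamma (((n : ℂ) - 1)/2 - lam) * Complex.Gamma (1/2 + lam))) *
  ∫ t in (0:ℝ)..1, (t : ℂ) ^ (((n : ℂ) - 1)/2 - lam - 1) *
    ((1 : ℂ) - (t : ℂ)) ^ (lam - 1/2) *
    ((1 : ℂ) - z * (t : ℂ)) ^ (-(((n : ℂ) - 1)/2) - lam)

/-- General term of the Gauss hypergeometric series `₂F₁(a,b;c;w)`. -/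
def hypTerm (a b c : ℂ) (w : ℂ) (k : ℕ) : ℂ :=
  (ascPochhammer ℂ k).eval a * (ascPochhammer ℂ k).eval b /
    ((ascPochhammer ℂ k).eval c * (k.factorial : ℂ)) * w ^ k

/-- The curve `z_t = (i cos t, 0, …, 0, sin t)` in the crown `Ξ`. -/
def zCurve (n : ℕ) (t : ℝ) : Fin (n+1) → ℂ :=
  fun i => if i = 0 then Complex.I * (Real.cos t : ℂ)
    else if i = Fin.last n then (Real.sin t : ℂ) else 0

/-- The curve `z̃_t = (−i cos t, 0, …, 0, sin t)` in the conjugate crown `Ξ̄`. -/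
def zCurveBar (n : ℕ) (t : ℝ) : Fin (n+1) → ℂ :=
  fun i => if i = 0 then -Complex.I * (Real.cos t : ℂ)
    else if i = Fin.last n then (Real.sin t : ℂ) else 0

/-- The open future cone `Γ⁺(eₙ)` in `dS^n`. -/
def futureCone (n : ℕ) : Set (Fin (n+1) → ℝ) :=
  {y | lformR n y y = 1 ∧ lformR n (y - elast n) (y - elast n) < 0 ∧ 0 < y 0}

/-- The open past cone `Γ⁻(eₙ)` in `dS^n`. -/
def pastCone (n : ℕ) : Set (Fin (n+1) → ℝ) :=
  {y | lformR n y y = 1 ∧ lformR n (y - elast n) (y - elast n) < 0 ∧ y 0 < 0}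


/-- The boundary value expression in Statement 12 (sign `s = ∓1` for `x ± i0`). -/
def bval (n : ℕ) (lam : ℂ) (x : ℝ) (s : ℝ) : ℂ :=
  (Complex.Gamma ((n : ℂ)/2) * Complex.Gamma ((2 - (n : ℂ))/2) /
      (Complex.Gamma (1/2 + lam) * Complex.Gamma (1/2 - lam))) *
    ∑' k : ℕ, hypTerm (((n : ℂ) - 1)/2 + lam) (((n : ℂ) - 1)/2 - lam) ((n : ℂ)/2)
      ((1 : ℂ) - x) k
  + Complex.exp ((s : ℂ) * (Real.pi : ℂ) * Complex.I * ((2 - (n : ℂ))/2)) *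
      (((x - 1) ^ ((2 - (n : ℝ))/2) : ℝ) : ℂ) *
      (Complex.Gamma ((n : ℂ)/2) * Complex.Gamma (((n : ℂ) - 2)/2) /
        (Complex.Gamma (((n : ℂ) - 1)/2 + lam) * Complex.Gamma (((n : ℂ) - 1)/2 - lam))) *
    ∑' k : ℕ, hypTerm (1/2 - lam) (1/2 + lam) ((4 - (n : ℂ))/2) ((1 : ℂ) - x) k

end

/-- Differentiation under the integral sign for a jointly `C¹` family of functions on `[0,1]`
integrated against a fixed integrable weight. -/
lemma hasDerivAt_integral_weight_mul {g : ℝ → ℂ}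
    (hg : IntervalIntegrable g MeasureTheory.volume 0 1) {Φ Φ' : ℂ → ℝ → ℂ} {U : Set ℂ}
    (hU : IsOpen U)
    (hΦ : ∀ κ ∈ U, ∀ t ∈ Set.Icc (0 : ℝ) 1, HasDerivAt (fun κ => Φ κ t) (Φ' κ t) κ)
    (hc : ContinuousOn (Function.uncurry Φ) (U ×ˢ Set.Icc (0 : ℝ) 1))
    (hc' : ContinuousOn (Function.uncurry Φ') (U ×ˢ Set.Icc (0 : ℝ) 1))
    {κ₀ : ℂ} (hκ₀ : κ₀ ∈ U) :
    IntervalIntegrable (fun t => g t * Φ' κ₀ t) MeasureTheory.volume 0 1 ∧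
    HasDerivAt (fun κ => ∫ t in (0 : ℝ)..1, g t * Φ κ t)
      (∫ t in (0 : ℝ)..1, g t * Φ' κ₀ t) κ₀ := by
  have slice {Ψ : ℂ → ℝ → ℂ} (h : ContinuousOn (Function.uncurry Ψ) (U ×ˢ Set.Icc (0 : ℝ) 1))
      {κ : ℂ} (hκ : κ ∈ U) :
      IntervalIntegrable (fun t => g t * Ψ κ t) MeasureTheory.volume 0 1 := by
    refine hg.mul_continuousOn ?_
    rw [Set.uIcc_of_le zero_le_one]
    exact h.comp (f := fun t : ℝ => (κ, t)) (by fun_prop) (fun t ht => ⟨hκ, ht⟩)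
  obtain ⟨r, hr, hrU⟩ := Metric.nhds_basis_closedBall.mem_iff.mp (hU.mem_nhds hκ₀)
  obtain ⟨C, hC⟩ := ((isCompact_closedBall κ₀ r).prod
    (isCompact_Icc (a := (0 : ℝ)) (b := 1))).exists_bound_of_continuousOn
      (hc'.mono (Set.prod_mono_left hrU))
  have sub : Set.uIoc (0 : ℝ) 1 ⊆ Set.Icc 0 1 := by
    rw [Set.uIoc_of_le zero_le_one]; exact Set.Ioc_subset_Icc_self
  refine intervalIntegral.hasDerivAt_integral_of_dominated_loc_of_deriv_le
    (F := fun κ t => g t * Φ κ t) (F' := fun κ t => g t * Φ' κ t) (bound := fun t => ‖g t‖ * C) (Metric.closedBall_mem_nhds κ₀ hr) ?_ (slice hc hκ₀)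
    (slice hc' hκ₀).aestronglyMeasurable_restrict_uIoc ?_ (hg.norm.mul_const C) ?_
  · filter_upwards [hU.mem_nhds hκ₀] with κ hκ
    exact (slice hc hκ).aestronglyMeasurable_restrict_uIoc
  · refine Eventually.of_forall fun t ht κ hκ => ?_
    rw [norm_mul]
    exact mul_le_mul_of_nonneg_left (hC (κ, t) ⟨hκ, sub ht⟩) (norm_nonneg _)
  · exact Eventually.of_forall fun t ht κ hκ => (hΦ κ (hrU hκ) t (sub ht)).const_mul _

lemma one_sub_add_mul_mem_slitPlane {v : ℂ} (hv : v ∈ Complex.slitPlane) {t : ℝ}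
    (ht : t ∈ Set.Icc (0 : ℝ) 1) : 1 - (t : ℂ) + v * t ∈ Complex.slitPlane := by
  have h := Complex.starConvex_one_slitPlane hv (sub_nonneg.mpr ht.2) ht.1 (by ring)
  convert h using 1
  simp [mul_comm]

lemma continuousOn_one_sub_add_mul_cpow {U : Set ℂ} {w : ℂ}
    (hU : ∀ κ ∈ U, κ * w ∈ Complex.slitPlane) (c : ℂ) :
    ContinuousOn (fun q : ℂ × ℝ => (1 - (q.2 : ℂ) + q.1 * w * q.2) ^ c)
      (U ×ˢ Set.Icc (0 : ℝ) 1) := by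
  refine ContinuousOn.cpow (by fun_prop) continuousOn_const fun q hq => ?_
  exact one_sub_add_mul_mem_slitPlane (hU q.1 hq.1) hq.2

/-- The integral `∫₀¹ t^{α-1} (1-t)^{β-1} (1-t+vt)^p (1-t+wt)^c dt`. -/
noncomputable def twoPointEuler (α β p c v w : ℂ) : ℂ :=
  ∫ t in (0 : ℝ)..1, ((t : ℂ) ^ (α - 1) * (1 - (t : ℂ)) ^ (β - 1)) *
    ((1 - (t : ℂ) + v * t) ^ p * (1 - (t : ℂ) + w * t) ^ c)

lemma continuousAt_twoPointEuler {α β p c v w : ℂ} (hα : 0 < α.re) (hβ : 0 < β.re)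
    (hv : v ∈ Complex.slitPlane) (hw : w ∈ Complex.slitPlane) :
    ContinuousAt (twoPointEuler α β p c v) w := by
  have cv : ContinuousOn (fun q : ℂ × ℝ => (1 - (q.2 : ℂ) + v * q.2) ^ p)
      (Complex.slitPlane ×ˢ Set.Icc (0 : ℝ) 1) :=
    ContinuousOn.cpow (by fun_prop) continuousOn_const
      fun q hq => one_sub_add_mul_mem_slitPlane hv hq.2
  have cw (c : ℂ) := continuousOn_one_sub_add_mul_cpow (U := Complex.slitPlane) (w := 1)
    (by simp) c
  simp only [mul_one] at cw
  refine (hasDerivAt_integral_weight_mul (Complex.betaIntegral_convergent hα hβ)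
    (Φ := fun w t => (1 - (t : ℂ) + v * t) ^ p * (1 - (t : ℂ) + w * t) ^ c)
    (Φ' := fun w t => (1 - (t : ℂ) + v * t) ^ p *
      (c * (1 - (t : ℂ) + w * t) ^ (c - 1) * (1 * t)))
    Complex.isOpen_slitPlane (fun κ hκ t ht => ?_) ?_ ?_ hw).2.continuousAt
  · exact (((((hasDerivAt_id κ).mul_const (t : ℂ)).const_add _).cpow_const
      (one_sub_add_mul_mem_slitPlane hκ ht)).const_mul _)
  · exact cv.mul (cw c)
  · exact cv.mul ((continuousOn_const.mul (cw (c - 1))).mul (by fun_prop))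

/-- With `α + β + p + c = 0`, the function `κ ↦ κ^α J(κ, κw)` is locally constant: its derivative
is the integral of a total derivative vanishing at both endpoints. -/
lemma hasDerivAt_cpow_mul_twoPointEuler {α β p c w κ : ℂ} (hα : 0 < α.re) (hβ : 0 < β.re)
    (hsum : α + β + p + c = 0) (hκ : κ ∈ Complex.slitPlane) (hκw : κ * w ∈ Complex.slitPlane) :
    HasDerivAt (fun κ => κ ^ α * twoPointEuler α β p c κ (κ * w)) 0 κ := by
  set U : Set ℂ := {κ | κ ∈ Complex.slitPlane ∧ κ * w ∈ Complex.slitPlane}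
  have hU : IsOpen U := Complex.isOpen_slitPlane.inter
    (Complex.isOpen_slitPlane.preimage (continuous_mul_const w))
  have cκ (a : ℂ) : ContinuousOn (fun q : ℂ × ℝ => q.1 ^ a) (U ×ˢ Set.Icc (0 : ℝ) 1) :=
    ContinuousOn.cpow (by fun_prop) continuousOn_const fun q hq => hq.1.1
  have cP (a : ℂ) := continuousOn_one_sub_add_mul_cpow (U := U) (w := 1)
    (fun κ hκ => by simpa using hκ.1) a
  simp only [mul_one] at cP
  have cQ (a : ℂ) := continuousOn_one_sub_add_mul_cpow (U := U) (w := w) (fun κ hκ => hκ.2) a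
  set Φ' : ℂ → ℝ → ℂ := fun κ t =>
    (α * κ ^ (α - 1) * 1) * ((1 - (t : ℂ) + κ * t) ^ p * (1 - (t : ℂ) + κ * w * t) ^ c) +
    κ ^ α * ((p * (1 - (t : ℂ) + κ * t) ^ (p - 1) * (1 * t)) * (1 - (t : ℂ) + κ * w * t) ^ c +
      (1 - (t : ℂ) + κ * t) ^ p * (c * (1 - (t : ℂ) + κ * w * t) ^ (c - 1) * (1 * w * t)))
    with hΦ'
  obtain ⟨hint, hder⟩ := hasDerivAt_integral_weight_mul
    (Complex.betaIntegral_convergent hα hβ)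
    (Φ := fun κ t => κ ^ α *
      ((1 - (t : ℂ) + κ * t) ^ p * (1 - (t : ℂ) + κ * w * t) ^ c))
    (Φ' := Φ') hU
    (fun κ hκ t ht => by
      have hP := (((hasDerivAt_id κ).mul_const (t : ℂ)).const_add (1 - (t : ℂ))).cpow_const
        (c := p) (one_sub_add_mul_mem_slitPlane hκ.1 ht)
      have hQ := ((((hasDerivAt_id κ).mul_const w).mul_const (t : ℂ)).const_add
        (1 - (t : ℂ))).cpow_const (c := c) (one_sub_add_mul_mem_slitPlane hκ.2 ht)
      exact ((hasDerivAt_id κ).cpow_const hκ.1).mul (hP.mul hQ))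
    ((cκ α).mul ((cP p).mul (cQ c)))
    ((((continuousOn_const.mul (cκ (α - 1))).mul continuousOn_const).mul
        ((cP p).mul (cQ c))).add
      ((cκ α).mul ((((continuousOn_const.mul (cP (p - 1))).mul (by fun_prop)).mul (cQ c)).add
        ((cP p).mul ((continuousOn_const.mul (cQ (c - 1))).mul (by fun_prop))))))
    (show κ ∈ U from ⟨hκ, hκw⟩)
  have hα0 : α ≠ 0 := fun h => by simp [h] at hα
  have hβ0 : β ≠ 0 := fun h => by simp [h] at hβ
  have hκ0 : κ ≠ 0 := Complex.slitPlane_ne_zero hκ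
  have split {x : ℂ} (hx : x ≠ 0) (a : ℂ) : x ^ a = x ^ (a - 1) * x := by
    rw [Complex.cpow_sub _ _ hx, Complex.cpow_one, div_mul_cancel₀ _ hx]
  have hzero : ∫ t in (0 : ℝ)..1, ((t : ℂ) ^ (α - 1) * (1 - (t : ℂ)) ^ (β - 1)) * Φ' κ t = 0 := by
    have key := intervalIntegral.integral_eq_sub_of_hasDerivAt_of_le zero_le_one
      (f := fun t : ℝ => κ ^ (α - 1) * (((t : ℂ) ^ α * (1 - (t : ℂ)) ^ β) *
        ((1 - (t : ℂ) + κ * t) ^ p * (1 - (t : ℂ) + κ * w * t) ^ c)))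
      (f' := fun t => ((t : ℂ) ^ (α - 1) * (1 - (t : ℂ)) ^ (β - 1)) * Φ' κ t) ?_ ?_ hint
    · rw [key]
      simp [Complex.zero_cpow hα0, Complex.zero_cpow hβ0]
    · have ct : Continuous fun t : ℝ => (t : ℂ) ^ α :=
        Complex.continuous_ofReal_cpow_const hα
      have ct' : Continuous fun t : ℝ => (1 - (t : ℂ)) ^ β := by
        have := (Complex.continuous_ofReal_cpow_const hβ).comp (continuous_sub_left (1 : ℝ))
        simpa [Function.comp_def] using this
      have hpair : Set.MapsTo (fun t : ℝ => (κ, t)) (Set.Icc 0 1) (U ×ˢ Set.Icc (0 : ℝ) 1) :=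
        fun t ht => ⟨⟨hκ, hκw⟩, ht⟩
      exact continuousOn_const.mul ((ct.mul ct').continuousOn.mul
        (((cP p).comp (by fun_prop) hpair).mul ((cQ c).comp (by fun_prop) hpair)))
    · intro t ht
      have ht' : t ∈ Set.Icc (0 : ℝ) 1 := Set.Ioo_subset_Icc_self ht
      have sP := one_sub_add_mul_mem_slitPlane hκ ht'
      have sQ := one_sub_add_mul_mem_slitPlane hκw ht'
      have st : (t : ℂ) ∈ Complex.slitPlane := Complex.ofReal_mem_slitPlane.mpr ht.1
      have st' : 1 - (t : ℂ) ∈ Complex.slitPlane := by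
        have := Complex.ofReal_mem_slitPlane.mpr (sub_pos.mpr ht.2)
        simpa using this
      have did := hasDerivAt_id (t : ℂ)
      have d := (((did.cpow_const (c := α) st).mul
        ((did.const_sub 1).cpow_const (c := β) st')).mul
        ((((did.const_sub 1).add (did.const_mul κ)).cpow_const (c := p) sP).mul
          (((did.const_sub 1).add (did.const_mul (κ * w))).cpow_const (c := c) sQ))).const_mul
          (κ ^ (α - 1))
      refine d.comp_ofReal.congr_deriv ?_
      simp only [hΦ', id_eq, Pi.add_apply, Pi.mul_apply]
      rw [split (Complex.slitPlane_ne_zero st) α, split (Complex.slitPlane_ne_zero st') β,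
        split (Complex.slitPlane_ne_zero sP) p, split (Complex.slitPlane_ne_zero sQ) c,
        split hκ0 α]
      obtain rfl : p = -(α + β + c) := by linear_combination hsum
      ring
  rw [hzero] at hder
  convert hder using 2 with κ'
  rw [twoPointEuler, ← intervalIntegral.integral_const_mul]
  congr 1
  ext t
  ring

/-- Rotation of the Euler integral by a quarter turn. -/
lemma twoPointEuler_one_eq_rotate {α β p c w : ℂ} (hα : 0 < α.re) (hβ : 0 < β.re)
    (hsum : α + β + p + c = 0) {σ : ℝ} (hσ : σ ≠ 0) (hw : 0 < σ * w.im) :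
    twoPointEuler α β p c 1 w =
      (-(σ * Complex.I)) ^ α * twoPointEuler α β p c (-(σ * Complex.I)) (-(σ * Complex.I) * w) := by
  have hderiv (r : ℝ) (hr : r ∈ Set.Icc (0 : ℝ) 1) : HasDerivAt (fun r : ℝ =>
      (fun κ => κ ^ α * twoPointEuler α β p c κ (κ * w)) (1 - r + -(σ * Complex.I) * r)) 0 r := by
    have h1 : 1 - (r : ℂ) + -(σ * Complex.I) * r ∈ Complex.slitPlane := by
      refine one_sub_add_mul_mem_slitPlane ?_ hr
      simp [Complex.mem_slitPlane_iff, hσ]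
    have h2 : (1 - (r : ℂ) + -(σ * Complex.I) * r) * w ∈ Complex.slitPlane := by
      rw [Complex.mem_slitPlane_iff]
      by_contra! hcon
      simp at hcon
      obtain ⟨hre, him⟩ := hcon
      have hr0 := hr.1
      have hr1 := hr.2
      have e : 0 < (1 - r) ^ 2 * (σ * w.im) + r ^ 2 * σ ^ 2 * (σ * w.im) := by
        rcases eq_or_lt_of_le hr0 with h | h
        · subst h; simpa using hw
        · positivity
      have e2 : (1 - r) ^ 2 * (σ * w.im) + r ^ 2 * σ ^ 2 * (σ * w.im) =
          (1 - r) * σ * ((1 - r) * w.im + -(σ * r * w.re)) +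
            r * σ ^ 2 * ((1 - r) * w.re + σ * r * w.im) := by ring
      rw [e2, him, mul_zero, zero_add] at e
      have e3 : 0 ≤ r * σ ^ 2 := by positivity
      exact absurd e (mul_nonpos_of_nonneg_of_nonpos e3 hre).not_gt
    have hd := hasDerivAt_cpow_mul_twoPointEuler (w := w) hα hβ hsum h1 h2
    have hlin : HasDerivAt (fun z : ℂ => 1 - z + -(σ * Complex.I) * z)
        (-1 + -(σ * Complex.I) * 1) (r : ℂ) :=
      ((hasDerivAt_id _).const_sub 1).add ((hasDerivAt_id _).const_mul _)
    simpa using (HasDerivAt.comp (r : ℂ) hd hlin).comp_ofReal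
  have := constant_of_has_deriv_right_zero
    (fun r hr => (hderiv r hr).continuousAt.continuousWithinAt)
    (fun r hr => (hderiv r (Set.Ico_subset_Icc_self hr)).hasDerivWithinAt) 1 (by simp)
  simpa using this.symm

lemma Flam_eq_twoPointEuler (n : ℕ) (lam z p : ℂ) :
    Flam n lam z = (Complex.Gamma ((n : ℂ)/2) /
      (Complex.Gamma (((n : ℂ) - 1)/2 - lam) * Complex.Gamma (1/2 + lam))) *
      twoPointEuler (((n : ℂ) - 1)/2 - lam) (1/2 + lam) p (-(((n : ℂ) - 1)/2) - lam) 1 (1 - z) := by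
  rw [Flam, twoPointEuler]
  congr 2
  ext t
  have h1 : 1 - (t : ℂ) + 1 * t = 1 := by ring
  have h2 : 1 - (t : ℂ) + (1 - z) * t = 1 - z * t := by ring
  have h3 : 1/2 + lam - 1 = lam - 1/2 := by ring
  rw [h1, h2, h3, Complex.one_cpow, one_mul]

/-- `F_λ` has a limit at `x > 1` from each of the open half planes `{σ Im z < 0}`. -/
lemma exists_tendsto_Flam (n : ℕ) (hn : 2 ≤ n) (lam : ℂ) (hlam : admissible n lam)
    {x : ℝ} (hx : 1 < x) {σ : ℝ} (hσ : σ ≠ 0) :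
    ∃ L : ℂ, Tendsto (Flam n lam) (𝓝[{z | σ * z.im < 0}] (x : ℂ)) (𝓝 L) := by
  have hn' : (2 : ℝ) ≤ n := by exact_mod_cast hn
  have hα : 0 < (((n : ℂ) - 1)/2 - lam).re := by
    have : (((n : ℂ) - 1)/2 - lam).re = ((n : ℝ) - 1)/2 - lam.re := by simp
    rw [this]
    rcases hlam with h | h <;> linarith [h.1, h.2]
  have hβ : 0 < (1/2 + lam).re := by
    have : (1/2 + lam).re = 1/2 + lam.re := by simp
    rw [this]
    rcases hlam with h | h <;> linarith [h.1, h.2]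
  set α := ((n : ℂ) - 1)/2 - lam
  set β := 1/2 + lam
  set c := -(((n : ℂ) - 1)/2) - lam
  set p := -(α + β + c) with hp
  set κ : ℂ := -(σ * Complex.I) with hκ
  have hκs : κ ∈ Complex.slitPlane := by simp [hκ, Complex.mem_slitPlane_iff, hσ]
  have hκx : κ * (1 - x) ∈ Complex.slitPlane := by
    rw [Complex.mem_slitPlane_iff]
    right
    simp [hκ, hσ, sub_eq_zero, hx.ne]
  have hcont : ContinuousAt (fun z : ℂ => twoPointEuler α β p c κ (κ * (1 - z))) x :=
    ContinuousAt.comp (f := fun z : ℂ => κ * (1 - z))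
      (continuousAt_twoPointEuler hα hβ hκs hκx) (by fun_prop)
  refine ⟨_, Tendsto.congr' ?_ ((hcont.tendsto.const_mul (κ ^ α)).const_mul
    (Complex.Gamma ((n : ℂ)/2) / (Complex.Gamma α * Complex.Gamma β)) |>.mono_left
      nhdsWithin_le_nhds)⟩
  filter_upwards [self_mem_nhdsWithin] with z hz
  rw [Flam_eq_twoPointEuler n lam z p, twoPointEuler_one_eq_rotate hα hβ (by rw [hp]; ring) hσ]
  simpa using hz

lemma lformC_zCurve (n : ℕ) (hn : n ≠ 0) (y : Fin (n+1) → ℝ) (t : ℝ) :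
    lformC n (zCurve n t) (fun i => (y i : ℂ)) =
      (Real.sin t * y (Fin.last n) : ℝ) - (Real.cos t * y 0 : ℝ) * Complex.I := by
  have h0 : Fin.last n ≠ 0 := by
    rw [Ne, Fin.ext_iff]; simpa using hn
  rw [lformC, Finset.sum_eq_add (0 : Fin (n+1)) (Fin.last n) h0.symm]
  · simp [zCurve, h0]
    ring
  · rintro i - ⟨hi, hi'⟩
    simp [zCurve, hi, hi']
  · simp
  · simp

lemma one_lt_last_of_mem_cones {n : ℕ} (hn : n ≠ 0) {y : Fin (n+1) → ℝ}
    (hy : lformR n y y = 1)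
    (hy' : lformR n (y - elast n) (y - elast n) < 0) : 1 < y (Fin.last n) := by
  have h0 : Fin.last n ≠ 0 := by
    rw [Ne, Fin.ext_iff]; simpa using hn
  have : lformR n (y - elast n) (y - elast n) = lformR n y y + (1 - 2 * y (Fin.last n)) := by
    have hs : (1 - 2 * y (Fin.last n)) =
        ∑ i, if i = Fin.last n then 1 - 2 * y (Fin.last n) else 0 := by simp
    rw [hs, lformR, lformR, ← Finset.sum_add_distrib]
    refine Finset.sum_congr rfl fun i _ => ?_
    by_cases hi : i = Fin.last n
    · subst hi
      simp [elast, h0]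
      ring
    · simp [elast, hi]
  linarith

open Filter Topology in
theorem stmt16 (n : ℕ) (hn : 2 ≤ n) (lam : ℂ) (hlam : admissible n lam)
    (y : Fin (n+1) → ℝ) (hy : y ∈ futureCone n ∪ pastCone n)
    (s : ℝ) (hs : s = if 0 < y 0 then 1 else -1) :
    (∀ t ∈ Set.Ioo (0 : ℝ) (Real.pi/2),
      (1 + lformC n (zCurve n t) (fun i => (y i : ℂ)))/2 ∉ slit) ∧
    ∃ L : ℂ,
      Tendsto (fun ε : ℝ => Flam n lam (((1 + y (Fin.last n))/2 : ℝ) - (s : ℂ) * (ε : ℂ) * Complex.I))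
        (𝓝[>] (0 : ℝ)) (𝓝 L) ∧
      Tendsto (fun t : ℝ => Flam n lam ((1 + lformC n (zCurve n t) (fun i => (y i : ℂ)))/2))
        (𝓝[<] (Real.pi/2)) (𝓝 L) := by
  have hn0 : n ≠ 0 := by omega
  have hlast : 1 < y (Fin.last n) := by
    rcases hy with h | h <;> exact one_lt_last_of_mem_cones hn0 h.1 h.2.1
  have hsy : 0 < s * y 0 := by
    rcases hy with h | h
    · have := h.2.2
      simp [hs, this]
    · have := h.2.2
      simpa [hs, this.not_gt] using this
  have hs0 : s ≠ 0 := left_ne_zero_of_mul hsy.ne'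
  have hy0 : y 0 ≠ 0 := right_ne_zero_of_mul hsy.ne'
  have him (t : ℝ) : ((1 + lformC n (zCurve n t) (fun i => (y i : ℂ)))/2).im =
      -(Real.cos t * y 0) / 2 := by
    rw [lformC_zCurve n hn0, Complex.div_ofNat_im]
    simp only [Complex.add_im, Complex.sub_im, Complex.one_im, Complex.ofReal_im, Complex.mul_im,
      Complex.I_re, Complex.I_im, Complex.ofReal_re]
    ring
  refine ⟨fun t ht hmem => ?_, ?_⟩
  · have hcos := Real.cos_pos_of_mem_Ioo ⟨by linarith [ht.1, Real.pi_pos], ht.2⟩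
    have h := hmem.1
    rw [him] at h
    have : Real.cos t * y 0 = 0 := by linarith
    exact mul_ne_zero hcos.ne' hy0 this
  · obtain ⟨L, hL⟩ := exists_tendsto_Flam n hn lam hlam
      (x := (1 + y (Fin.last n))/2) (by linarith) hs0
    refine ⟨L, hL.comp (tendsto_nhdsWithin_iff.mpr ⟨?_, ?_⟩),
      hL.comp (tendsto_nhdsWithin_iff.mpr ⟨?_, ?_⟩)⟩
    · refine (Continuous.tendsto' ?_ 0 _ ?_).mono_left nhdsWithin_le_nhds
      · fun_prop
      · simp
    · filter_upwards [self_mem_nhdsWithin] with ε hε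
      have hε' : 0 < ε := hε
      have : 0 < s * (s * ε) := by
        rw [← mul_assoc]; exact mul_pos (mul_self_pos.mpr hs0) hε'
      simpa using this
    · simp only [lformC_zCurve n hn0]
      refine (Continuous.tendsto' ?_ (Real.pi/2) _ ?_).mono_left nhdsWithin_le_nhds
      · fun_prop
      · simp
    · filter_upwards [Ioo_mem_nhdsLT (show 0 < Real.pi/2 by positivity)] with t ht
      have hcos := Real.cos_pos_of_mem_Ioo ⟨by linarith [ht.1, Real.pi_pos], ht.2⟩
      have := mul_pos hcos hsy
      simp only [him]
      linarith
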